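/- arXiv:1005.3967 — 4 statements merged into one kernel-verified Lean document; each statement's English description precedes it below -/
import Mathlib

section
/- Let 1 ≤ k ≤ n be integers. A k × n matrix A with integer entries is unimodular (extendable to a matrix in GL_n(ℤ)) if and only if its full-rank minors are coprime, i.e., the greatest common divisor of all determinants of k × k submatrices of A (formed by choosing any k of the n columns) equals 1. -/
/-- A `k × n` integer matrix is unimodular if it can be extended (by `n - k` additional
integer rows) to an `n × n` integer matrix of determinant `±1`. -/
def IsUnimodularMat {k n : ℕ} (hk : k ≤ n) (A : Matrix (Fin k) (Fin n) ℤ) : Prop :=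
  ∃ M : Matrix (Fin n) (Fin n) ℤ,
    (M.det = 1 ∨ M.det = -1) ∧ ∀ (i : Fin k) (j : Fin n), M (Fin.castLE hk i) j = A i j

/-- The gcd of the full-rank (`k × k`) minors of a `k × n` integer matrix, where the
minors are indexed by the choices of `k` of the `n` columns. -/
noncomputable def minorsGcd {k n : ℕ} (A : Matrix (Fin k) (Fin n) ℤ) : ℤ :=
  Finset.univ.gcd (fun g : Fin k ↪ Fin n => (A.submatrix id g).det)

theorem aux_dvd_det {k n : ℕ} (A : Matrix (Fin k) (Fin n) ℤ) (B : Matrix (Fin n) (Fin k) ℤ)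
    (d : ℤ) (h : ∀ g : Fin k ↪ Fin n, d ∣ (A.submatrix id g).det) : d ∣ (A * B).det := by
  have h1 : (A * B).det = ∑ f : Fin k → Fin n, (∏ i, B (f i) i) * (A.submatrix id f).det := by
    rw [← Matrix.det_transpose]
    have h2 : (A * B).transpose = fun i => ∑ j, B j i • A.transpose j := by
      ext i l
      simp [Matrix.mul_apply, Finset.sum_apply, mul_comm]
    rw [h2]
    have h3 := (Matrix.detRowAlternating (n := Fin k) (R := ℤ)).toMultilinearMap.map_sum
      (fun (i : Fin k) (j : Fin n) => B j i • A.transpose j)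
    refine h3.trans (Finset.sum_congr rfl fun f _ => ?_)
    have h4 := (Matrix.detRowAlternating (n := Fin k) (R := ℤ)).toMultilinearMap.map_smul_univ
      (fun i => B (f i) i) (fun i => A.transpose (f i))
    refine h4.trans ?_
    rw [smul_eq_mul, ← Matrix.det_transpose (A.submatrix id f)]
    rfl
  rw [h1]
  refine Finset.dvd_sum fun f _ => Dvd.dvd.mul_left ?_ _
  by_cases hf : Function.Injective f
  · exact h ⟨f, hf⟩
  · simp only [Function.Injective, not_forall] at hf
    obtain ⟨i, j, hij, hne⟩ := hf
    rw [Matrix.det_zero_of_column_eq hne]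
    · exact dvd_zero _
    · intro l
      simp [hij]

theorem aux_surj {k n : ℕ} (A : Matrix (Fin k) (Fin n) ℤ) (h : minorsGcd A = 1) :
    Function.Surjective A.mulVecLin := by
  let I : Ideal ℤ :=
    { carrier := {c | ∀ v : Fin k → ℤ, c • v ∈ LinearMap.range A.mulVecLin}
      add_mem' := fun {a b} ha hb v => by
        rw [add_smul]; exact Submodule.add_mem _ (ha v) (hb v)
      zero_mem' := fun v => by
        rw [zero_smul]; exact Submodule.zero_mem _
      smul_mem' := fun c x hx v => by
        rw [smul_assoc]; exact Submodule.smul_mem _ _ (hx v) }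
  have hI : ∀ g : Fin k ↪ Fin n, (A.submatrix id g).det ∈ I := by
    intro g v
    refine ⟨((1 : Matrix (Fin n) (Fin n) ℤ).submatrix id g).mulVec
      ((A.submatrix id g).adjugate.mulVec v), ?_⟩
    rw [Matrix.mulVecLin_apply, Matrix.mulVec_mulVec]
    have : A * (1 : Matrix (Fin n) (Fin n) ℤ).submatrix id g = A.submatrix id g := by
      ext i j
      simp [Matrix.mul_apply, Matrix.one_apply]
    rw [this, Matrix.mulVec_mulVec, Matrix.mul_adjugate, Matrix.smul_mulVec, Matrix.one_mulVec]
  obtain ⟨d, hd⟩ := (IsPrincipalIdealRing.principal I).principal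
  have hd' : ∀ x, x ∈ I → d ∣ x := by
    intro x hx
    rw [hd] at hx
    exact Ideal.mem_span_singleton.1 hx
  have h1 : d ∣ 1 := by
    rw [← h]
    exact Finset.dvd_gcd fun g _ => hd' _ (hI g)
  have h2 : (1 : ℤ) ∈ I := by
    rw [hd]
    exact Ideal.mem_span_singleton.2 h1
  intro v
  have := h2 v
  rwa [one_smul] at this

theorem aux_ext {k n : ℕ} (hkn : k ≤ n) (A : Matrix (Fin k) (Fin n) ℤ)
    (h : Function.Surjective A.mulVecLin) : IsUnimodularMat hkn A := by
  obtain ⟨m, rfl⟩ := Nat.exists_eq_add_of_le hkn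
  obtain ⟨s, hs⟩ := Module.projective_lifting_property A.mulVecLin LinearMap.id h
  have hs' : ∀ v, A.mulVecLin (s v) = v := fun v => LinearMap.congr_fun hs v
  let K := LinearMap.ker A.mulVecLin
  let p : (Fin (k + m) → ℤ) →ₗ[ℤ] K :=
    LinearMap.codRestrict K (LinearMap.id - s ∘ₗ A.mulVecLin) (fun x => by
      rw [LinearMap.mem_ker, LinearMap.sub_apply, map_sub, LinearMap.comp_apply, hs']
      simp)
  have hp : ∀ x, (p x : Fin (k + m) → ℤ) = x - s (A.mulVecLin x) := fun x => rfl
  let e : (Fin (k + m) → ℤ) ≃ₗ[ℤ] (Fin k → ℤ) × K :=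
    LinearEquiv.ofBijective (A.mulVecLin.prod p) (by
      constructor
      · intro x y hxy
        have h1 : A.mulVecLin x = A.mulVecLin y := congrArg Prod.fst hxy
        have h2 : p x = p y := congrArg Prod.snd hxy
        have h3 := congrArg Subtype.val h2
        rw [hp, hp, h1] at h3
        exact sub_left_injective h3
      · rintro ⟨v, y, hy⟩
        have hy' : A.mulVecLin y = 0 := hy
        have h0 : A.mulVecLin (s v + y) = v := by rw [map_add, hs', hy', add_zero]
        refine ⟨s v + y, Prod.ext h0 (Subtype.ext ?_)⟩
        change ((p (s v + y) : K) : Fin (k + m) → ℤ) = y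
        rw [hp, h0]
        simp)
  have hr : Module.finrank ℤ K = m := by
    have := e.finrank_eq
    rw [Module.finrank_prod] at this
    simp at this
    exact this.symm
  let b : Module.Basis (Fin m) ℤ K := Module.finBasisOfFinrankEq ℤ K hr
  let E : (Fin (k + m) → ℤ) ≃ₗ[ℤ] (Fin (k + m) → ℤ) :=
    e ≪≫ₗ (LinearEquiv.refl ℤ (Fin k → ℤ)).prodCongr b.equivFun ≪≫ₗ
      (LinearEquiv.sumArrowLequivProdArrow (Fin k) (Fin m) ℤ ℤ).symm ≪≫ₗ
      LinearEquiv.funCongrLeft ℤ ℤ finSumFinEquiv.symm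
  refine ⟨LinearMap.toMatrix' (E : (Fin (k + m) → ℤ) →ₗ[ℤ] (Fin (k + m) → ℤ)), ?_, ?_⟩
  · rw [LinearMap.det_toMatrix']
    exact Int.isUnit_iff.1 (LinearEquiv.isUnit_det' E)
  · intro i j
    rw [LinearMap.toMatrix'_apply]
    have hc : Fin.castLE hkn i = Fin.castAdd m i := rfl
    have : ∀ x, E x (Fin.castAdd m i) = A.mulVecLin x i := by
      intro x
      simp [E, e, LinearEquiv.funCongrLeft_apply, LinearMap.funLeft_apply]
      rfl
    rw [hc]
    refine (this _).trans ?_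
    simp [Matrix.mulVec_single]

theorem unimodular_iff_minors_coprime (k n : ℕ) (hk : 1 ≤ k) (hkn : k ≤ n)
    (A : Matrix (Fin k) (Fin n) ℤ) :
    IsUnimodularMat hkn A ↔ minorsGcd A = 1 := by
  constructor
  · rintro ⟨M, hM, hA⟩
    have hu : IsUnit M.det := Int.isUnit_iff.2 hM
    have hAB : A * (M⁻¹).submatrix id (Fin.castLE hkn) = 1 := by
      have h1 : A = M.submatrix (Fin.castLE hkn) id := by
        ext i j
        exact (hA i j).symm
      rw [h1, ← Matrix.submatrix_mul _ _ _ _ _ Function.bijective_id, Matrix.mul_nonsing_inv _ hu]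
      exact Matrix.submatrix_one _ (Fin.castLE_injective hkn)
    have h2 := aux_dvd_det A ((M⁻¹).submatrix id (Fin.castLE hkn)) (minorsGcd A)
      (fun g => Finset.gcd_dvd (Finset.mem_univ g))
    rw [hAB, Matrix.det_one] at h2
    have h3 : normalize (minorsGcd A) = minorsGcd A := Finset.normalize_gcd
    rw [← h3]
    exact normalize_eq_one.2 (isUnit_of_dvd_one h2)
  · intro h
    exact aux_ext hkn A (aux_surj A h)
end

section
/- Let 1 ≤ k < n be integers. The upper natural density of the set of k × n integer matrices A for which there exists a prime p > x dividing every k × k minor of A tends to 0 as x → ∞; more precisely, this upper density is at most ∑_{p prime, p > x} 2/p². -/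
open Filter Topology

/-- The number of matrices in `S` all of whose entries lie in `[-B, B)`. -/
noncomputable def matBoxCount (k n : ℕ) (S : Set (Matrix (Fin k) (Fin n) ℤ)) (B : ℕ) : ℕ :=
  Set.ncard {A ∈ S | ∀ i j, -(B : ℤ) ≤ A i j ∧ A i j < (B : ℤ)}

/-- The ratio `|S ∩ [-B,B)^{k×n}| / (2B)^{kn}`. -/
noncomputable def matDensityRatio (k n : ℕ) (S : Set (Matrix (Fin k) (Fin n) ℤ)) (B : ℕ) : ℝ :=
  (matBoxCount k n S B : ℝ) / (2 * (B : ℝ)) ^ (k * n)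

/-- The upper natural density of a set of `k × n` integer matrices. -/
noncomputable def upperMatDensity (k n : ℕ) (S : Set (Matrix (Fin k) (Fin n) ℤ)) : ℝ :=
  limsup (matDensityRatio k n S) atTop

/-- The set of `k × n` integer matrices all of whose `k × k` minors are divisible by
some prime `p > x`. -/
def largePrimeDividesMinors (k n x : ℕ) : Set (Matrix (Fin k) (Fin n) ℤ) :=
  {A | ∃ p : ℕ, p.Prime ∧ x < p ∧ ∀ g : Fin k ↪ Fin n, (p : ℤ) ∣ (A.submatrix id g).det}


lemma exists_minor_ne_zero {K : Type*} [Field K] {k n : ℕ} (M : Matrix (Fin k) (Fin n) K)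
    (h : LinearIndependent K M) : ∃ g : Fin k ↪ Fin n, (M.submatrix id g).det ≠ 0 := by
  have hr : M.rank = k := by
    have := LinearIndependent.rank_matrix (M := M) h
    simpa using this
  rw [Matrix.rank_eq_finrank_span_cols] at hr
  have hex : ∃ f : Fin k → (Fin k → K), (∀ i, f i ∈ Set.range M.col) ∧ LinearIndependent K f := by
    obtain ⟨f, hf, -, hli⟩ := Submodule.exists_fun_fin_finrank_span_eq K (Set.range M.col)
    exact ⟨f ∘ Fin.cast hr.symm, fun i => hf _, hli.comp _ (Fin.cast_injective _)⟩
  obtain ⟨f, hf, hli⟩ := hex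
  choose g hg using hf
  have hinj : Function.Injective g := by
    intro a b hab
    apply hli.injective
    rw [← hg a, ← hg b, hab]
  refine ⟨⟨g, hinj⟩, ?_⟩
  have : LinearIndependent K (M.submatrix id g).col := by
    have e : (M.submatrix id g).col = f := by
      funext j
      rw [← hg j]
      rfl
    rw [e]; exact hli
  rw [Matrix.linearIndependent_cols_iff_isUnit, Matrix.isUnit_iff_isUnit_det] at this
  exact this.ne_zero

lemma prod_lower (p : ℝ) (hp : 2 ≤ p) (n k : ℕ) (hk : k < n) :
    1 - 2 / p ^ 2 ≤ ∏ i : Fin k, (1 - p ^ (i : ℕ) / p ^ n) := by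
  have hp0 : 0 < p := by linarith
  have key : ∀ m : ℕ, m ≤ k → 1 - 2 * p ^ m / p ^ (n + 1) ≤ ∏ i : Fin m, (1 - p ^ (i : ℕ) / p ^ n) := by
    intro m
    induction m with
    | zero =>
      intro _
      simp
      positivity
    | succ m ih =>
      intro hm
      rw [Fin.prod_univ_castSucc]
      simp only [Fin.val_castSucc, Fin.val_last]
      have h1 := ih (by omega)
      have hle : p ^ m / p ^ n ≤ 1 := by
        rw [div_le_one (by positivity)]
        exact pow_le_pow_right₀ (by linarith) (by omega)
      refine le_trans ?_ (mul_le_mul_of_nonneg_right h1 (by linarith))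
      have e1 : 2 * p ^ m / p ^ (n + 1) = (2 / p) * (p ^ m / p ^ n) := by
        rw [pow_succ]; field_simp
      have e2 : 2 * p ^ (m+1) / p ^ (n + 1) = 2 * (p ^ m / p ^ n) := by
        rw [pow_succ, pow_succ]; field_simp
      rw [e1, e2]
      have h3 : 2 / p ≤ 1 := by rw [div_le_one hp0]; exact hp
      have h4 : 0 ≤ p ^ m / p ^ n := by positivity
      have h5 : 0 ≤ 2 / p := by positivity
      nlinarith [mul_nonneg h5 (mul_nonneg h4 h4), mul_nonneg h4 (sub_nonneg.2 h3)]
  refine le_trans ?_ (key k le_rfl)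
  have : 2 * p ^ k / p ^ (n + 1) ≤ 2 / p ^ 2 := by
    rw [div_le_div_iff₀ (by positivity) (by positivity), mul_assoc, ← pow_add]
    exact mul_le_mul_of_nonneg_left (pow_le_pow_right₀ (by linarith) (by omega)) (by norm_num)
  linarith

lemma card_dep (p : ℕ) [Fact p.Prime] (k n : ℕ) (hk : k < n) :
    (Nat.card {M : Fin k → Fin n → ZMod p // ¬ LinearIndependent (ZMod p) M} : ℝ)
      ≤ 2 / (p : ℝ) ^ 2 * (p : ℝ) ^ (k * n) := by
  classical
  have hp : 2 ≤ p := (Fact.out : p.Prime).two_le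
  have hp' : (2 : ℝ) ≤ p := by exact_mod_cast hp
  have hc := card_linearIndependent (K := ZMod p) (V := Fin n → ZMod p) (k := k) (by simp; omega)
  have hsum : Nat.card {M : Fin k → Fin n → ZMod p // LinearIndependent (ZMod p) M} +
     Nat.card {M : Fin k → Fin n → ZMod p // ¬ LinearIndependent (ZMod p) M} = p ^ (k * n) := by
    rw [← Nat.card_sum, Nat.card_congr (Equiv.sumCompl _)]
    simp [← pow_mul, mul_comm]
  have hsum' : (Nat.card {M : Fin k → Fin n → ZMod p // LinearIndependent (ZMod p) M} : ℝ) +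
     Nat.card {M : Fin k → Fin n → ZMod p // ¬ LinearIndependent (ZMod p) M} = (p : ℝ) ^ (k * n) := by
    exact_mod_cast hsum
  have h2 : (Nat.card {M : Fin k → Fin n → ZMod p // LinearIndependent (ZMod p) M} : ℝ) =
      (p : ℝ) ^ (k * n) * ∏ i : Fin k, (1 - (p : ℝ) ^ (i : ℕ) / (p : ℝ) ^ n) := by
    rw [hc]
    have : (p : ℝ) ^ (k * n) = ∏ i : Fin k, (p : ℝ) ^ n := by
      simp [← pow_mul, mul_comm]
    rw [this, ← Finset.prod_mul_distrib]
    push_cast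
    refine Finset.prod_congr rfl fun i _ => ?_
    simp only [ZMod.card, Module.finrank_fintype_fun_eq_card, Fintype.card_fin]
    rw [Nat.cast_sub (Nat.pow_le_pow_right (by omega) (by omega))]
    push_cast
    field_simp
  have h3 := prod_lower p hp' n k hk
  have h4 : (0:ℝ) ≤ (p : ℝ) ^ (k * n) := by positivity
  nlinarith [mul_le_mul_of_nonneg_left h3 h4]

/-- the box -/
noncomputable def bx (k n B : ℕ) : Finset (Fin k × Fin n → ℤ) :=
  Fintype.piFinset fun _ => Finset.Ico (-(B : ℤ)) B

lemma card_bx (k n B : ℕ) : (bx k n B).card = (2 * B) ^ (k * n) := by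
  simp [bx]
  congr 1; omega

lemma card_residue (B p : ℕ) (hp : 0 < p) (v : ℤ) :
    (((Finset.Ico (-(B : ℤ)) B).filter fun x => x ≡ v [ZMOD p]).card : ℝ) ≤ 2 * B / p + 1 := by
  have h := Int.Ico_filter_modEq_card (-(B : ℤ)) B (r := (p : ℤ)) (by exact_mod_cast hp) v
  have h1 := Int.ceil_lt_add_one (((B : ℤ) - v) / ((p : ℤ) : ℚ) : ℚ)
  have h2 := Int.le_ceil (((-(B : ℤ) : ℤ) - v) / ((p : ℤ) : ℚ) : ℚ)
  have hpq : (0 : ℚ) < p := by exact_mod_cast hp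
  have : ((((Finset.Ico (-(B : ℤ)) B).filter fun x => x ≡ v [ZMOD p]).card : ℤ) : ℚ) ≤ 2 * B / p + 1 := by
    rw [h, Int.cast_max]
    apply max_le
    · push_cast at *
      have e : (2 * B / p : ℚ) = (B - v) / p - (-B - v)/p := by field_simp; ring
      linarith
    · push_cast; positivity
  have h5 : (((((Finset.Ico (-(B : ℤ)) B).filter fun x => x ≡ v [ZMOD p]).card : ℤ) : ℚ) : ℝ) ≤ ((2 * B / p + 1 : ℚ) : ℝ) := by
    exact_mod_cast this
  push_cast at h5
  exact h5

lemma count_p (k n B p : ℕ) (hk : k < n) (hp : p.Prime) (S : Finset (Fin k × Fin n → ℤ))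
    (hS : S ⊆ bx k n B)
    (h : ∀ A ∈ S, ∀ g : Fin k ↪ Fin n, (p : ℤ) ∣ (Matrix.of fun i j : Fin k => A (i, g j)).det) :
    (S.card : ℝ) ≤ 2 / (p : ℝ) ^ 2 * (p * (2 * B / p + 1)) ^ (k * n) := by
  classical
  have : Fact p.Prime := ⟨hp⟩
  let F : (Fin k × Fin n → ℤ) → (Fin k → Fin n → ZMod p) := fun A i j => (A (i, j) : ZMod p)
  let T : Finset (Fin k → Fin n → ZMod p) := Finset.univ.filter fun M => ¬ LinearIndependent (ZMod p) M
  have hT : (T.card : ℝ) ≤ 2 / (p : ℝ) ^ 2 * (p : ℝ) ^ (k * n) := by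
    have := card_dep p k n hk
    rwa [Nat.card_eq_fintype_card, Fintype.card_subtype] at this
  have hmap : ∀ A ∈ S, F A ∈ T := by
    intro A hA
    simp only [T, Finset.mem_filter, Finset.mem_univ, true_and]
    intro hli
    obtain ⟨g, hg⟩ := exists_minor_ne_zero (F A) hli
    apply hg
    have := (ZMod.intCast_zmod_eq_zero_iff_dvd _ p).2 (h A hA g)
    rw [← this]
    have e := (Int.castRingHom (ZMod p)).map_det (Matrix.of fun i j : Fin k => A (i, g j))
    simp only [eq_intCast] at e
    rw [e]
    rfl
  have hfib : ∀ M ∈ T, ((S.filter fun A => F A = M).card : ℝ) ≤ (2 * B / p + 1) ^ (k * n) := by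
    intro M _
    have hsub : (S.filter fun A => F A = M) ⊆ Fintype.piFinset fun ij : Fin k × Fin n =>
        (Finset.Ico (-(B : ℤ)) B).filter fun x => x ≡ ((M ij.1 ij.2).val : ℤ) [ZMOD p] := by
      intro A hA
      rw [Finset.mem_filter] at hA
      have hb := hS hA.1
      rw [bx, Fintype.mem_piFinset] at hb
      rw [Fintype.mem_piFinset]
      intro ij
      rw [Finset.mem_filter]
      refine ⟨hb ij, ?_⟩
      rw [← ZMod.intCast_eq_intCast_iff]
      rw [← hA.2]
      simp [F]
    have h1 : ((S.filter fun A => F A = M).card : ℝ) ≤ _ := Nat.cast_le.2 (Finset.card_le_card hsub)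
    refine h1.trans ?_
    rw [Fintype.card_piFinset]
    push_cast
    refine (Finset.prod_le_prod (fun _ _ => by positivity) (fun ij _ => card_residue B p hp.pos _)).trans ?_
    simp
  have : (S.card : ℝ) ≤ T.card * (2 * B / p + 1) ^ (k * n) := by
    rw [Finset.card_eq_sum_card_fiberwise hmap]
    push_cast
    refine (Finset.sum_le_sum hfib).trans ?_
    simp
  refine this.trans ?_
  rw [mul_pow, ← mul_assoc]
  gcongr

/-- minor on the first `i` rows and columns `g` -/
def mnr {k n : ℕ} (A : Fin k × Fin n → ℤ) (i : ℕ) (h : i ≤ k) (g : Fin i → Fin n) : ℤ :=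
  (Matrix.of fun r c : Fin i => A (Fin.castLE h r, g c)).det

lemma mnr_update_col {k n : ℕ} (A : Fin k × Fin n → ℤ) (i : ℕ) (h : i ≤ k) (g : Fin i → Fin n)
    (r : Fin k) (b : Fin n) (hb : ∀ c, g c ≠ b) (t : ℤ) :
    mnr (Function.update A (r, b) t) i h g = mnr A i h g := by
  unfold mnr
  congr 2
  funext r' c
  rw [Function.update_of_ne]
  intro e
  exact hb c (congrArg Prod.snd e)

lemma mnr_update_row {k n : ℕ} (A : Fin k × Fin n → ℤ) (i : ℕ) (h : i < k) (g : Fin i → Fin n)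
    (b : Fin n) (t : ℤ) :
    mnr (Function.update A (⟨i, h⟩, b) t) i h.le g = mnr A i h.le g := by
  unfold mnr
  congr 2
  funext r' c
  rw [Function.update_of_ne]
  intro e
  have := congrArg (fun z => (Prod.fst z : Fin k).val) e
  simp at this
  omega

lemma mnr_snoc_update {k n : ℕ} (A : Fin k × Fin n → ℤ) (i : ℕ) (h : i < k) (J : Fin i → Fin n)
    (a : Fin n) (ha : ∀ c, J c ≠ a) (t : ℤ) :
    mnr (Function.update A (⟨i, h⟩, a) t) (i + 1) h (Fin.snoc J a : Fin (i + 1) → Fin n)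
      = mnr A (i + 1) h (Fin.snoc J a : Fin (i + 1) → Fin n) + (t - A (⟨i, h⟩, a)) * mnr A i h.le J := by
  have hsub : ∀ A' : Fin k × Fin n → ℤ, mnr A' (i + 1) h (Fin.snoc J a : Fin (i + 1) → Fin n) =
      (∑ c : Fin i, (-1) ^ (i + c : ℕ) * A' (⟨i, h⟩, J c) *
        (Matrix.of fun r c' : Fin i => A' (Fin.castLE h.le r,
          (Fin.snoc J a : Fin (i + 1) → Fin n) (c.castSucc.succAbove c'))).det)
      + A' (⟨i, h⟩, a) * mnr A' i h.le J := by
    intro A'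
    unfold mnr
    rw [Matrix.det_succ_row _ (Fin.last i), Fin.sum_univ_castSucc]
    congr 1
    · refine Finset.sum_congr rfl fun c _ => ?_
      simp only [Matrix.of_apply, Fin.snoc_castSucc, Fin.val_last, Fin.val_castSucc]
      congr 1
      congr 1
      ext r c'
      simp only [Matrix.submatrix_apply, Matrix.of_apply, Fin.succAbove_last]
      rfl
    · simp only [Matrix.of_apply, Fin.snoc_last, Fin.val_last]
      have : (-1 : ℤ) ^ (i + i) = 1 := by rw [← two_mul, pow_mul]; simp
      rw [this, one_mul]
      congr 1
      congr 1
      ext r c'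
      simp only [Matrix.submatrix_apply, Matrix.of_apply, Fin.succAbove_last, Fin.snoc_castSucc]
      rfl
  rw [hsub, hsub, mnr_update_row]
  have : ∀ (r : Fin i) (x : Fin n), Function.update A (⟨i, h⟩, a) t (Fin.castLE h.le r, x)
      = A (Fin.castLE h.le r, x) := by
    intro r x
    rw [Function.update_of_ne]
    intro e
    have := congrArg (fun z => (Prod.fst z : Fin k).val) e
    simp at this
    omega
  have h2 : ∀ c, Function.update A (⟨i, h⟩, a) t (⟨i, h⟩, J c) = A (⟨i, h⟩, J c) := by
    intro c
    rw [Function.update_of_ne]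
    intro e
    exact ha c (congrArg Prod.snd e)
  simp only [this, h2, Function.update_self]
  ring

lemma fibre {ι : Type*} [Fintype ι] [DecidableEq ι] (I : Finset ℤ) (c : ι) (m : ℕ)
    (S : Finset (ι → ℤ)) (hS : S ⊆ Fintype.piFinset fun _ => I)
    (h : ∀ f ∈ Fintype.piFinset (fun _ : ι => I), (I.filter fun t => Function.update f c t ∈ S).card ≤ m) :
    S.card * I.card ≤ m * I.card ^ Fintype.card ι := by
  classical
  have h1 : S.card * I.card ≤ ((Fintype.piFinset (fun _ : ι => I)).sigma
      fun f => I.filter fun t => Function.update f c t ∈ S).card := by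
    rw [← Finset.card_product]
    refine Finset.card_le_card_of_injOn
      (fun x => (⟨Function.update x.1 c x.2, x.1 c⟩ : Σ _ : ι → ℤ, ℤ)) ?_ ?_
    · rintro ⟨g, s⟩ hx
      simp only [Finset.coe_product, Set.mem_prod, Finset.mem_coe] at hx
      have hg := Fintype.mem_piFinset.1 (hS hx.1)
      simp only [Finset.mem_coe, Finset.mem_sigma, Finset.mem_filter, Fintype.mem_piFinset]
      refine ⟨?_, hg c, ?_⟩
      · intro a
        by_cases hac : a = c
        · subst hac; simpa using hx.2
        · simpa [hac] using hg a
      · simpa using hx.1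
    · rintro ⟨g, s⟩ _ ⟨g', s'⟩ _ e
      simp only [Sigma.mk.injEq, heq_eq_eq] at e
      obtain ⟨e1, e2⟩ := e
      have hs : s = s' := by simpa using congrFun e1 c
      have hg : g = g' := by
        funext a
        by_cases hac : a = c
        · subst hac; exact e2
        · simpa [hac] using congrFun e1 a
      rw [hs, hg]
  refine h1.trans ?_
  rw [Finset.card_sigma]
  refine (Finset.sum_le_sum h).trans ?_
  simp [mul_comm]

lemma few_primes (D : ℤ) (hD : D ≠ 0) (N c : ℕ) (hN : 1 < N) (hb : D.natAbs < N ^ (c + 1)) :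
    (D.natAbs.primeFactors.filter fun p => N ≤ p).card ≤ c := by
  have h1 : ∏ p ∈ D.natAbs.primeFactors.filter (fun p => N ≤ p), p ∣ D.natAbs := by
    apply Finset.prod_primes_dvd
    · intro p hp
      exact (Nat.prime_of_mem_primeFactors (Finset.mem_filter.1 hp).1).prime
    · intro p hp
      exact Nat.dvd_of_mem_primeFactors (Finset.mem_filter.1 hp).1
  have h2 := Nat.le_of_dvd (Int.natAbs_pos.2 hD) h1
  have h3 := Finset.pow_card_le_prod (D.natAbs.primeFactors.filter fun p => N ≤ p) (fun p => p) N
    (fun p hp => (Finset.mem_filter.1 hp).2)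
  have h4 := (h3.trans h2).trans_lt hb
  have := (Nat.pow_lt_pow_iff_right hN).1 h4
  omega

lemma mnr_bound {k n B : ℕ} (A : Fin k × Fin n → ℤ) (hA : A ∈ bx k n B) (hB : k.factorial ≤ B)
    (i : ℕ) (h : i ≤ k) (g : Fin i → Fin n) : (mnr A i h g).natAbs < (2 * B) ^ (k + 1) := by
  have hB1 : 1 ≤ B := (Nat.factorial_pos k).trans_le hB
  have hb := Fintype.mem_piFinset.1 hA
  have := Matrix.det_le (A := Matrix.of fun r c : Fin i => A (Fin.castLE h r, g c))
    (abv := AbsoluteValue.abs) (x := (B : ℤ)) (by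
      intro r c
      have := Finset.mem_Ico.1 (hb (Fin.castLE h r, g c))
      simp only [Matrix.of_apply, AbsoluteValue.abs_apply]
      exact abs_le.2 ⟨this.1, this.2.le⟩)
  simp only [AbsoluteValue.abs_apply, Fintype.card_fin, nsmul_eq_mul] at this
  have h2 : (mnr A i h g).natAbs ≤ i.factorial * B ^ i := by
    zify
    exact this
  calc (mnr A i h g).natAbs ≤ i.factorial * B ^ i := h2
    _ ≤ B * B ^ k := Nat.mul_le_mul ((Nat.factorial_le h).trans hB) (Nat.pow_le_pow_right hB1 h)
    _ = B ^ (k + 1) := by ring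
    _ < (2 * B) ^ (k + 1) := Nat.pow_lt_pow_left (by omega) (by omega)

lemma card_T1 (k n B i : ℕ) (h : i < k) (J : Fin i → Fin n) (a : Fin n) (ha : ∀ c, J c ≠ a)
    (S : Finset (Fin k × Fin n → ℤ)) (hS : S ⊆ bx k n B)
    (hm : ∀ A ∈ S, mnr A i h.le J ≠ 0)
    (h0 : ∀ A ∈ S, mnr A (i + 1) h (Fin.snoc J a : Fin (i + 1) → Fin n) = 0) :
    S.card * (2 * B) ≤ (2 * B) ^ (k * n) := by
  classical
  have := fibre (Finset.Ico (-(B : ℤ)) B) ((⟨i, h⟩, a) : Fin k × Fin n) 1 S hS (by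
    intro f _
    rw [Finset.card_le_one]
    intro s hs t ht
    rw [Finset.mem_filter] at hs ht
    have e1 := h0 _ hs.2
    have e2 := h0 _ ht.2
    have e3 := hm _ hs.2
    rw [mnr_update_row] at e3
    rw [mnr_snoc_update _ _ _ _ _ ha] at e1 e2
    have : (s - t) * mnr f i h.le J = 0 := by linear_combination e1 - e2
    rcases mul_eq_zero.1 this with h | h
    · linarith
    · exact absurd h e3)
  have e : ((B : ℤ) - -(B : ℤ)).toNat = 2 * B := by omega
  simpa only [Int.card_Ico, e, Fintype.card_prod, Fintype.card_fin, one_mul] using this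

lemma card_T2 (k n B i : ℕ) (hB : k.factorial ≤ B) (h : i < k) (J : Fin i → Fin n) (a b : Fin n)
    (hab : a ≠ b) (hb : ∀ c, J c ≠ b)
    (S : Finset (Fin k × Fin n → ℤ)) (hS : S ⊆ bx k n B)
    (h0 : ∀ A ∈ S, mnr A (i + 1) h (Fin.snoc J a : Fin (i + 1) → Fin n) ≠ 0)
    (hm : ∀ A ∈ S, ∃ p : ℕ, p.Prime ∧ 2 * B ≤ p ∧ ¬ (p : ℤ) ∣ mnr A i h.le J ∧
      (p : ℤ) ∣ mnr A (i + 1) h (Fin.snoc J a : Fin (i + 1) → Fin n) ∧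
      (p : ℤ) ∣ mnr A (i + 1) h (Fin.snoc J b : Fin (i + 1) → Fin n)) :
    S.card * (2 * B) ≤ k * (2 * B) ^ (k * n) := by
  classical
  have hB1 : 1 ≤ B := (Nat.factorial_pos k).trans_le hB
  have hcol : ∀ c, (Fin.snoc J a : Fin (i + 1) → Fin n) c ≠ b := by
    intro c
    refine Fin.lastCases ?_ (fun c => ?_) c
    · simpa using hab
    · simpa using hb c
  have := fibre (Finset.Ico (-(B : ℤ)) B) ((⟨i, h⟩, b) : Fin k × Fin n) k S hS (by
    intro f hf
    by_cases hD : mnr f (i + 1) h (Fin.snoc J a : Fin (i + 1) → Fin n) = 0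
    · rw [Finset.filter_false_of_mem]
      · simp
      · intro t _ ht
        apply h0 _ ht
        rw [mnr_update_col _ _ _ _ _ _ hcol, hD]
    refine le_trans ?_ (few_primes _ hD (2 * B) k (by omega) (mnr_bound f hf hB _ h _))
    have hm' : ∀ t : ℤ, Function.update f (⟨i, h⟩, b) t ∈ S → ∃ p : ℕ, p.Prime ∧ 2 * B ≤ p ∧ ¬ (p : ℤ) ∣ mnr f i h.le J ∧
      (p : ℤ) ∣ mnr f (i + 1) h (Fin.snoc J a : Fin (i + 1) → Fin n) ∧
      (p : ℤ) ∣ mnr f (i + 1) h (Fin.snoc J b : Fin (i + 1) → Fin n) + (t - f (⟨i, h⟩, b)) * mnr f i h.le J := by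
      intro t ht
      have := hm _ ht
      simpa only [mnr_update_col _ _ _ _ _ _ hcol, mnr_update_row, mnr_snoc_update _ _ _ _ _ hb] using this
    choose! P hP using hm'
    refine Finset.card_le_card_of_injOn P ?_ ?_
    · intro t ht
      have ht := (Finset.mem_filter.1 (Finset.mem_coe.1 ht)).2
      have q := hP t ht
      rw [Finset.mem_coe, Finset.mem_filter, Nat.mem_primeFactors]
      exact ⟨⟨q.1, Int.natCast_dvd.1 q.2.2.2.1, Int.natAbs_ne_zero.2 hD⟩, q.2.1⟩
    · intro s hs t ht e
      have hs := (Finset.mem_filter.1 (Finset.mem_coe.1 hs))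
      have ht := (Finset.mem_filter.1 (Finset.mem_coe.1 ht))
      have q := hP t ht.2
      have q' := hP s hs.2
      rw [e] at q'
      have hd : (P t : ℤ) ∣ (s - t) * mnr f i h.le J := by
        obtain ⟨u, hu⟩ := dvd_sub q'.2.2.2.2 q.2.2.2.2
        exact ⟨u, by linear_combination hu⟩
      have hd2 := ((Nat.prime_iff_prime_int.1 q.1).dvd_or_dvd hd).resolve_right q.2.2.1
      have i1 := Finset.mem_Ico.1 hs.1
      have i2 := Finset.mem_Ico.1 ht.1
      have := Int.eq_zero_of_abs_lt_dvd hd2 (by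
        have : (2 * B : ℤ) ≤ P t := by exact_mod_cast q.2.1
        rw [abs_lt]; constructor <;> linarith)
      linarith)
  have e : ((B : ℤ) - -(B : ℤ)).toNat = 2 * B := by omega
  simpa only [Int.card_Ico, e, Fintype.card_prod, Fintype.card_fin, one_mul] using this

lemma card_T (k n B i : ℕ) (hB : k.factorial ≤ B) (h : i < k) (J : Fin i → Fin n) (a b : Fin n)
    (hab : a ≠ b) (ha : ∀ c, J c ≠ a) (hb : ∀ c, J c ≠ b)
    (S : Finset (Fin k × Fin n → ℤ)) (hS : S ⊆ bx k n B)
    (hm : ∀ A ∈ S, ∃ p : ℕ, p.Prime ∧ 2 * B ≤ p ∧ ¬ (p : ℤ) ∣ mnr A i h.le J ∧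
      (p : ℤ) ∣ mnr A (i + 1) h (Fin.snoc J a : Fin (i + 1) → Fin n) ∧
      (p : ℤ) ∣ mnr A (i + 1) h (Fin.snoc J b : Fin (i + 1) → Fin n)) :
    S.card * (2 * B) ≤ (k + 1) * (2 * B) ^ (k * n) := by
  classical
  have h1 := card_T1 k n B i h J a ha
    (S.filter fun A => mnr A (i + 1) h (Fin.snoc J a : Fin (i + 1) → Fin n) = 0)
    ((Finset.filter_subset _ _).trans hS)
    (by
      intro A hA h0
      obtain ⟨p, _, _, h3, _⟩ := hm A (Finset.mem_filter.1 hA).1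
      exact h3 (h0 ▸ dvd_zero _))
    (fun A hA => (Finset.mem_filter.1 hA).2)
  have h2 := card_T2 k n B i hB h J a b hab hb
    (S.filter fun A => ¬ mnr A (i + 1) h (Fin.snoc J a : Fin (i + 1) → Fin n) = 0)
    ((Finset.filter_subset _ _).trans hS)
    (fun A hA => (Finset.mem_filter.1 hA).2)
    (fun A hA => hm A (Finset.mem_filter.1 hA).1)
  rw [← Finset.card_filter_add_card_filter_not
    (fun A => mnr A (i + 1) h (Fin.snoc J a : Fin (i + 1) → Fin n) = 0), add_mul, add_mul, one_mul]
  omega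

lemma exists_step {k n : ℕ} (hkn : k < n) (A : Fin k × Fin n → ℤ) (p : ℕ) (hp : p.Prime)
    (hA : ∀ g : Fin k ↪ Fin n, (p : ℤ) ∣ (Matrix.of fun i j : Fin k => A (i, g j)).det) :
    ∃ (i : Fin k) (J : Fin i → Fin n) (a b : Fin n), a ≠ b ∧ (∀ c, J c ≠ a) ∧ (∀ c, J c ≠ b) ∧
      ¬ (p : ℤ) ∣ mnr A i i.2.le J ∧
      (p : ℤ) ∣ mnr A (i + 1) i.2 (Fin.snoc J a : Fin (i + 1) → Fin n) ∧
      (p : ℤ) ∣ mnr A (i + 1) i.2 (Fin.snoc J b : Fin (i + 1) → Fin n) := by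
  classical
  let P : ℕ → Prop := fun i => ∀ h : i ≤ k, ∀ g : Fin i → Fin n, Function.Injective g → (p : ℤ) ∣ mnr A i h g
  have hPk : P k := fun h g hg => hA ⟨g, hg⟩
  have hP0 : ¬ P 0 := by
    intro h
    have := h (Nat.zero_le _) Fin.elim0 (fun x => x.elim0)
    simp [mnr] at this
    exact hp.one_lt.ne' (by
      have := Int.natAbs_dvd_natAbs.2 this
      simpa using this)
  have hex : ∃ i, P i := ⟨k, hPk⟩
  obtain ⟨i, hi⟩ : ∃ i, Nat.find hex = i + 1 := by
    refine Nat.exists_eq_succ_of_ne_zero fun h => ?_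
    exact hP0 (h ▸ Nat.find_spec hex)
  have h1 : P (i + 1) := hi ▸ Nat.find_spec hex
  have h2 : ¬ P i := Nat.find_min hex (by omega)
  have h3 : i + 1 ≤ k := hi ▸ Nat.find_min' hex hPk
  simp only [P, not_forall] at h2
  obtain ⟨h4, J, hJ, hJp⟩ := h2
  have hc : 1 < (Finset.univ.image J)ᶜ.card := by
    rw [Finset.card_compl, Finset.card_image_of_injective _ hJ]
    simp
    omega
  obtain ⟨a, ha, b, hb, hab⟩ := Finset.one_lt_card.1 hc
  simp only [Finset.mem_compl, Finset.mem_image, Finset.mem_univ, true_and, not_exists] at ha hb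
  refine ⟨⟨i, h3⟩, J, a, b, hab, ha, hb, hJp, h1 h3 _ ?_, h1 h3 _ ?_⟩
  · rw [Fin.snoc_injective_iff]; exact ⟨hJ, by rintro ⟨c, hc⟩; exact ha c hc⟩
  · rw [Fin.snoc_injective_iff]; exact ⟨hJ, by rintro ⟨c, hc⟩; exact hb c hc⟩

lemma card_large (k n : ℕ) (hkn : k < n) : ∃ C : ℕ, ∀ B : ℕ, k.factorial ≤ B →
    ∀ S : Finset (Fin k × Fin n → ℤ), S ⊆ bx k n B →
    (∀ A ∈ S, ∃ p : ℕ, p.Prime ∧ 2 * B ≤ p ∧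
      ∀ g : Fin k ↪ Fin n, (p : ℤ) ∣ (Matrix.of fun i j : Fin k => A (i, g j)).det) →
    S.card * (2 * B) ≤ C * (2 * B) ^ (k * n) := by
  classical
  refine ⟨Fintype.card (Σ i : Fin k, (Fin i → Fin n) × Fin n × Fin n) * (k + 1), ?_⟩
  intro B hB S hS h
  let Q : (Σ i : Fin k, (Fin i → Fin n) × Fin n × Fin n) → (Fin k × Fin n → ℤ) → Prop := fun x A =>
    x.2.2.1 ≠ x.2.2.2 ∧ (∀ c, x.2.1 c ≠ x.2.2.1) ∧ (∀ c, x.2.1 c ≠ x.2.2.2) ∧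
    ∃ p : ℕ, p.Prime ∧ 2 * B ≤ p ∧ ¬ (p : ℤ) ∣ mnr A x.1 x.1.2.le x.2.1 ∧
      (p : ℤ) ∣ mnr A (x.1 + 1) x.1.2 (Fin.snoc x.2.1 x.2.2.1 : Fin (x.1 + 1) → Fin n) ∧
      (p : ℤ) ∣ mnr A (x.1 + 1) x.1.2 (Fin.snoc x.2.1 x.2.2.2 : Fin (x.1 + 1) → Fin n)
  have hsub : S ⊆ Finset.univ.biUnion fun x => S.filter (Q x) := by
    intro A hA
    obtain ⟨p, hp, hpB, hg⟩ := h A hA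
    obtain ⟨i, J, a, b, hab, ha, hb, h1, h2, h3⟩ := exists_step hkn A p hp hg
    rw [Finset.mem_biUnion]
    exact ⟨⟨i, J, a, b⟩, Finset.mem_univ _, Finset.mem_filter.2 ⟨hA, hab, ha, hb, p, hp, hpB, h1, h2, h3⟩⟩
  have hx : ∀ x, (S.filter (Q x)).card * (2 * B) ≤ (k + 1) * (2 * B) ^ (k * n) := by
    rintro ⟨i, J, a, b⟩
    by_cases hc : a ≠ b ∧ (∀ c, J c ≠ a) ∧ (∀ c, J c ≠ b)
    · exact card_T k n B i hB i.2 J a b hc.1 hc.2.1 hc.2.2 _ ((Finset.filter_subset _ _).trans hS)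
        (fun A hA => (Finset.mem_filter.1 hA).2.2.2.2)
    · rw [Finset.filter_false_of_mem]
      · simp
      · intro A _ hq
        exact hc ⟨hq.1, hq.2.1, hq.2.2.1⟩
  calc S.card * (2 * B) ≤ (∑ x, (S.filter (Q x)).card) * (2 * B) :=
        Nat.mul_le_mul_right _ ((Finset.card_le_card hsub).trans Finset.card_biUnion_le)
    _ = ∑ x, (S.filter (Q x)).card * (2 * B) := Finset.sum_mul _ _ _
    _ ≤ ∑ x : (Σ i : Fin k, (Fin i → Fin n) × Fin n × Fin n), (k + 1) * (2 * B) ^ (k * n) :=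
        Finset.sum_le_sum fun x _ => hx x
    _ = _ := by rw [Finset.sum_const, Finset.card_univ, smul_eq_mul, mul_assoc]

open Classical in
/-- dominated terms -/
noncomputable def trm (k n x B p : ℕ) : ℝ :=
  if p.Prime ∧ x < p ∧ p < 2 * B then 2 / (p : ℝ) ^ 2 * (1 + p / (2 * B)) ^ (k * n) else 0

open Classical in
/-- limit terms -/
noncomputable def trm0 (x p : ℕ) : ℝ :=
  if p.Prime ∧ x < p then 2 / (p : ℝ) ^ 2 else 0

lemma ratio_le (k n : ℕ) (hkn : k < n) : ∃ C : ℕ, ∀ x B : ℕ, k.factorial ≤ B →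
    matDensityRatio k n (largePrimeDividesMinors k n x) B ≤ ∑' p, trm k n x B p + C / (2 * B) := by
  classical
  obtain ⟨C, hC⟩ := card_large k n hkn
  refine ⟨C, fun x B hB => ?_⟩
  have hB1 : 1 ≤ B := (Nat.factorial_pos k).trans_le hB
  have hBr : (0 : ℝ) < 2 * B := by positivity
  let R : ℕ → (Fin k × Fin n → ℤ) → Prop := fun p A =>
    ∀ g : Fin k ↪ Fin n, (p : ℤ) ∣ (Matrix.of fun i j : Fin k => A (i, g j)).det
  let S : Finset (Fin k × Fin n → ℤ) := (bx k n B).filter fun A => ∃ p : ℕ, p.Prime ∧ x < p ∧ R p A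
  let L : Finset (Fin k × Fin n → ℤ) := (bx k n B).filter fun A => ∃ p : ℕ, p.Prime ∧ 2 * B ≤ p ∧ R p A
  let Pr : Finset ℕ := (Finset.range (2 * B)).filter fun p => p.Prime ∧ x < p
  have h1 : matBoxCount k n (largePrimeDividesMinors k n x) B ≤ S.card := by
    unfold matBoxCount
    rw [← Set.ncard_coe_finset S]
    refine Set.ncard_le_ncard_of_injOn (fun A => Function.uncurry A) ?_ ?_ (Finset.finite_toSet _)
    · rintro A ⟨⟨p, hp, hx, hg⟩, hb⟩
      rw [Finset.mem_coe, Finset.mem_filter]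
      refine ⟨?_, p, hp, hx, hg⟩
      rw [bx, Fintype.mem_piFinset]
      rintro ⟨i, j⟩
      exact Finset.mem_Ico.2 (hb i j)
    · intro A _ A' _ e
      exact Function.LeftInverse.injective Function.curry_uncurry e
  have h2 : S ⊆ (Pr.biUnion fun p => (bx k n B).filter (R p)) ∪ L := by
    intro A hA
    obtain ⟨hA, p, hp, hx, hg⟩ := Finset.mem_filter.1 hA
    rw [Finset.mem_union]
    by_cases hpB : p < 2 * B
    · left
      rw [Finset.mem_biUnion]
      exact ⟨p, Finset.mem_filter.2 ⟨Finset.mem_range.2 hpB, hp, hx⟩, Finset.mem_filter.2 ⟨hA, hg⟩⟩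
    · right
      exact Finset.mem_filter.2 ⟨hA, p, hp, not_lt.1 hpB, hg⟩
  have h3 : S.card ≤ ∑ p ∈ Pr, ((bx k n B).filter (R p)).card + L.card :=
    (Finset.card_le_card h2).trans ((Finset.card_union_le _ _).trans
      (Nat.add_le_add_right Finset.card_biUnion_le _))
  have hL := hC B hB L (Finset.filter_subset _ _) (fun A hA => (Finset.mem_filter.1 hA).2)
  have hL' : (L.card : ℝ) ≤ C / (2 * B) * (2 * B) ^ (k * n) := by
    have : (L.card : ℝ) * (2 * B) ≤ C * (2 * B) ^ (k * n) := by exact_mod_cast hL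
    rw [div_mul_eq_mul_div, le_div_iff₀ hBr]
    exact this
  have hp : ∀ p ∈ Pr, (((bx k n B).filter (R p)).card : ℝ) ≤ trm k n x B p * (2 * B) ^ (k * n) := by
    intro p hp
    obtain ⟨hp1, hp2, hp3⟩ := Finset.mem_filter.1 hp
    have := count_p k n B p hkn hp2 ((bx k n B).filter (R p)) (Finset.filter_subset _ _)
      (fun A hA => (Finset.mem_filter.1 hA).2)
    refine this.trans (le_of_eq ?_)
    rw [trm, if_pos ⟨hp2, hp3, Finset.mem_range.1 hp1⟩, mul_assoc, ← mul_pow]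
    have : (p : ℝ) ≠ 0 := by exact_mod_cast hp2.ne_zero
    congr 2
    field_simp
  have ht : ∑' p, trm k n x B p = ∑ p ∈ Pr, trm k n x B p := by
    apply tsum_eq_sum
    intro p hp
    rw [trm, if_neg]
    rintro ⟨a, b, c⟩
    exact hp (Finset.mem_filter.2 ⟨Finset.mem_range.2 c, a, b⟩)
  rw [matDensityRatio, div_le_iff₀ (by positivity), ht, add_mul, Finset.sum_mul]
  calc (matBoxCount k n (largePrimeDividesMinors k n x) B : ℝ) ≤ S.card := by exact_mod_cast h1
    _ ≤ ((∑ p ∈ Pr, ((bx k n B).filter (R p)).card + L.card : ℕ) : ℝ) := by exact_mod_cast h3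
    _ = ∑ p ∈ Pr, (((bx k n B).filter (R p)).card : ℝ) + L.card := by push_cast; rfl
    _ ≤ _ := add_le_add (Finset.sum_le_sum hp) hL'

lemma summable_bd (c : ℝ) : Summable fun p : ℕ => c * (2 / (p : ℝ) ^ 2) := by
  have : Summable fun p : ℕ => 1 / (p : ℝ) ^ 2 := Real.summable_one_div_nat_pow.2 (by norm_num)
  refine ((this.mul_left (c * 2))).congr fun p => by ring

lemma tendsto_trm (k n x : ℕ) :
    Tendsto (fun B => ∑' p, trm k n x B p) atTop (𝓝 (∑' p, trm0 x p)) := by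
  refine tendsto_tsum_of_dominated_convergence (summable_bd (2 ^ (k * n))) ?_ ?_
  · intro p
    by_cases hp : p.Prime ∧ x < p
    · have h1 : Tendsto (fun B : ℕ => 2 / (p : ℝ) ^ 2 * (1 + p / (2 * (B : ℝ))) ^ (k * n)) atTop
          (𝓝 (trm0 x p)) := by
        have e : trm0 x p = 2 / (p : ℝ) ^ 2 * (1 + 0) ^ (k * n) := by simp [trm0, hp]
        rw [e]
        refine Tendsto.const_mul _ (Tendsto.pow (tendsto_const_nhds.add ?_) _)
        exact Tendsto.div_atTop tendsto_const_nhds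
          (Tendsto.const_mul_atTop (by norm_num) tendsto_natCast_atTop_atTop)
      refine h1.congr' ?_
      filter_upwards [eventually_gt_atTop p] with B hB
      rw [trm, if_pos ⟨hp.1, hp.2, by omega⟩]
    · have e : trm0 x p = 0 := by rw [trm0, if_neg hp]
      have e2 : ∀ B, trm k n x B p = 0 := fun B => by
        rw [trm, if_neg]; rintro ⟨a, b, _⟩; exact hp ⟨a, b⟩
      simp [e, e2]
  · filter_upwards [eventually_ge_atTop 1] with B hB p
    have hBr : (0 : ℝ) < 2 * B := by positivity
    unfold trm
    split_ifs with h
    · rw [Real.norm_of_nonneg (by positivity), mul_comm]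
      gcongr
      have : (p : ℝ) ≤ 2 * B := by exact_mod_cast h.2.2.le
      have : (p : ℝ) / (2 * B) ≤ 1 := by rw [div_le_one hBr]; exact this
      linarith
    · simp; positivity

lemma tendsto_trm0 : Tendsto (fun x => ∑' p, trm0 x p) atTop (𝓝 0) := by
  have : Tendsto (fun x => ∑' p, trm0 x p) atTop (𝓝 (∑' _ : ℕ, (0 : ℝ))) := by
    refine tendsto_tsum_of_dominated_convergence (summable_bd 1) ?_ ?_
    · intro p
      refine tendsto_const_nhds.congr' ?_
      filter_upwards [eventually_ge_atTop p] with x hx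
      rw [trm0, if_neg]
      omega
    · refine Eventually.of_forall fun x p => ?_
      unfold trm0
      split_ifs
      · rw [Real.norm_of_nonneg (by positivity), one_mul]
      · simp; positivity
  simpa using this

lemma trm0_eq (x : ℕ) : ∑' p, trm0 x p = ∑' p : {p : ℕ // p.Prime ∧ x < p}, 2 / ((p : ℕ) : ℝ) ^ 2 := by
  classical
  have := tsum_subtype {p : ℕ | p.Prime ∧ x < p} (fun p : ℕ => 2 / (p : ℝ) ^ 2)
  refine Eq.trans ?_ this.symm
  refine tsum_congr fun p => ?_
  simp [trm0, Set.indicator_apply]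

lemma ratio_nonneg (k n : ℕ) (S : Set (Matrix (Fin k) (Fin n) ℤ)) (B : ℕ) :
    0 ≤ matDensityRatio k n S B := by
  unfold matDensityRatio; positivity

lemma density_le (k n : ℕ) (hkn : k < n) (x : ℕ) :
    0 ≤ upperMatDensity k n (largePrimeDividesMinors k n x) ∧
    upperMatDensity k n (largePrimeDividesMinors k n x) ≤ ∑' p, trm0 x p := by
  obtain ⟨C, hC⟩ := ratio_le k n hkn
  have ht : Tendsto (fun B : ℕ => ∑' p, trm k n x B p + C / (2 * (B : ℝ))) atTop
      (𝓝 (∑' p, trm0 x p)) := by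
    have := (tendsto_trm k n x).add (Tendsto.div_atTop (tendsto_const_nhds (x := (C : ℝ)))
          (Tendsto.const_mul_atTop (show (0:ℝ) < 2 by norm_num) tendsto_natCast_atTop_atTop))
    simpa using this
  have hev : matDensityRatio k n (largePrimeDividesMinors k n x) ≤ᶠ[atTop]
      (fun B : ℕ => ∑' p, trm k n x B p + C / (2 * (B : ℝ))) := by
    filter_upwards [eventually_ge_atTop k.factorial] with B hB using hC x B hB
  have hbd : IsBoundedUnder (· ≤ ·) atTop (matDensityRatio k n (largePrimeDividesMinors k n x)) :=
    ht.isBoundedUnder_le.mono_le hev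
  constructor
  · exact le_limsup_of_frequently_le (Frequently.of_forall fun B => ratio_nonneg _ _ _ B) hbd
  · rw [upperMatDensity, ← ht.limsup_eq]
    exact limsup_le_limsup hev
      (isCoboundedUnder_le_of_le atTop (fun B => ratio_nonneg _ _ _ B)) ht.isBoundedUnder_le

theorem upper_density_large_prime_divides_minors (k n : ℕ) (hk : 1 ≤ k) (hkn : k < n) :
    Tendsto (fun x : ℕ => upperMatDensity k n (largePrimeDividesMinors k n x))
      atTop (𝓝 0) ∧
    ∀ x : ℕ, upperMatDensity k n (largePrimeDividesMinors k n x) ≤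
      ∑' p : {p : ℕ // p.Prime ∧ x < p}, 2 / ((p : ℕ) : ℝ) ^ 2 := by
  refine ⟨tendsto_of_tendsto_of_tendsto_of_le_of_le tendsto_const_nhds tendsto_trm0
    (fun x => (density_le k n hkn x).1) (fun x => (density_le k n hkn x).2), fun x => ?_⟩
  rw [← trm0_eq]
  exact (density_le k n hkn x).2
end

section
/- (Cesàro's theorem, obtained as the case k = 1 of the main result.) For every integer n ≥ 2, the set of n-tuples (a_1, …, a_n) ∈ ℤ^n with gcd(a_1, …, a_n) = 1 has a well-defined natural density equal to 1/ζ(n); in particular, for n = 2 the density of coprime pairs of integers is 6/π². -/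
open Filter Topology

/-- The number of points of `S ⊆ ℤ^m` all of whose coordinates lie in `[-B, B)`. -/
noncomputable def vecBoxCount (m : ℕ) (S : Set (Fin m → ℤ)) (B : ℕ) : ℕ :=
  Set.ncard {x ∈ S | ∀ i, -(B : ℤ) ≤ x i ∧ x i < (B : ℤ)}

/-- The ratio `|S ∩ [-B,B)^m| / (2B)^m`. -/
noncomputable def vecDensityRatio (m : ℕ) (S : Set (Fin m → ℤ)) (B : ℕ) : ℝ :=
  (vecBoxCount m S B : ℝ) / (2 * (B : ℝ)) ^ m

/-- `S ⊆ ℤ^m` has natural density `d`. -/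
def HasVecDensity (m : ℕ) (S : Set (Fin m → ℤ)) (d : ℝ) : Prop :=
  Tendsto (vecDensityRatio m S) atTop (𝓝 d)

noncomputable def mulCount (B d : ℕ) : ℕ := ((Finset.Ico (-(B : ℤ)) B).filter (fun x => (d : ℤ) ∣ x)).card

lemma mulCount_abs (B d : ℕ) (hd : 1 ≤ d) :
    |(mulCount B d : ℝ) - 2 * B / d| ≤ 1 := by
  have hd' : (0 : ℤ) < d := by exact_mod_cast hd
  have h := Int.Ico_filter_dvd_card (-(B : ℤ)) B hd'
  have hmono : ⌈((-(B : ℤ) : ℤ) : ℚ) / ((d : ℤ) : ℚ)⌉ ≤ ⌈((B : ℤ) : ℚ) / ((d : ℤ) : ℚ)⌉ := by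
    apply Int.ceil_mono
    have : (0 : ℚ) < ((d : ℤ) : ℚ) := by exact_mod_cast hd'
    apply div_le_div_of_nonneg_right _ this.le
    push_cast
    have : (0 : ℚ) ≤ B := by positivity
    linarith
  rw [max_eq_left (by linarith)] at h
  have a1 := Int.le_ceil (((-(B : ℤ) : ℤ) : ℚ) / ((d : ℤ) : ℚ))
  have a2 := Int.ceil_lt_add_one (((-(B : ℤ) : ℤ) : ℚ) / ((d : ℤ) : ℚ))
  have a3 := Int.le_ceil (((B : ℤ) : ℚ) / ((d : ℤ) : ℚ))
  have a4 := Int.ceil_lt_add_one (((B : ℤ) : ℚ) / ((d : ℤ) : ℚ))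
  have h' : (mulCount B d : ℚ) = (⌈((B : ℤ) : ℚ) / ((d : ℤ) : ℚ)⌉ : ℚ)
      - (⌈((-(B : ℤ) : ℤ) : ℚ) / ((d : ℤ) : ℚ)⌉ : ℚ) := by
    rw [mulCount]
    exact_mod_cast h
  have key : |(mulCount B d : ℚ) - 2 * B / d| ≤ 1 := by
    rw [h', abs_le]
    have e1 : ((-(B : ℤ) : ℤ) : ℚ) / ((d : ℤ) : ℚ) = - ((B : ℚ) / d) := by push_cast; ring
    have e2 : ((B : ℤ) : ℚ) / ((d : ℤ) : ℚ) = (B : ℚ) / d := by push_cast; ring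
    have e3 : 2 * (B : ℚ) / d = 2 * ((B : ℚ) / d) := by ring
    rw [e1] at a1 a2 ⊢
    rw [e2] at a3 a4 ⊢
    rw [e3]
    constructor <;> linarith
  have key2 := (Rat.cast_le (K := ℝ)).2 key
  push_cast at key2
  exact key2

lemma mulCount_large (B d : ℕ) (hB : 1 ≤ B) (hd : B < d) : mulCount B d = 1 := by
  rw [mulCount, Finset.card_eq_one]
  refine ⟨0, ?_⟩
  ext x
  simp only [Finset.mem_filter, Finset.mem_Ico, Finset.mem_singleton]
  constructor
  · rintro ⟨⟨h1, h2⟩, h3⟩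
    apply Int.eq_zero_of_abs_lt_dvd h3
    rw [abs_lt]; constructor <;> omega
  · rintro rfl
    simp; omega

lemma card_nonzero (n B d : ℕ) (hB : 1 ≤ B) :
    ((((Fintype.piFinset (fun _ : Fin n => Finset.Ico (-(B : ℤ)) B)).erase 0).filter
      (fun x => ∀ i, (d : ℤ) ∣ x i)).card : ℤ) = (mulCount B d : ℤ) ^ n - 1 := by
  have : ((Fintype.piFinset (fun _ : Fin n => Finset.Ico (-(B : ℤ)) B)).erase 0).filter
      (fun x => ∀ i, (d : ℤ) ∣ x i) =
      (Fintype.piFinset (fun _ : Fin n =>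
        (Finset.Ico (-(B : ℤ)) B).filter (fun x => (d : ℤ) ∣ x))).erase 0 := by
    ext x
    simp only [Finset.mem_filter, Finset.mem_erase, Fintype.mem_piFinset, forall_and]
    tauto
  have hmem : (0 : Fin n → ℤ) ∈ (Fintype.piFinset (fun _ : Fin n =>
        (Finset.Ico (-(B : ℤ)) B).filter (fun x => (d : ℤ) ∣ x))) := by
    simp [Fintype.mem_piFinset]; omega
  have hc := Finset.card_erase_add_one hmem
  rw [this]
  rw [Fintype.card_piFinset_const] at hc
  rw [mulCount]
  rw [eq_sub_iff_add_eq]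
  exact_mod_cast hc

lemma sum_moebius_gcd (n B : ℕ) (x : Fin n → ℤ) (hx : x ≠ 0)
    (hxB : ∀ i, x i ∈ Finset.Ico (-(B : ℤ)) B) :
    (if Finset.univ.gcd x = 1 then (1 : ℤ) else 0) =
      ∑ d ∈ Finset.Icc 1 B, if (∀ i, (d : ℤ) ∣ x i) then ArithmeticFunction.moebius d else 0 := by
  have hiff : ∀ d : ℕ, (∀ i, (d : ℤ) ∣ x i) ↔ d ∣ (Finset.univ.gcd x).natAbs := by
    intro d
    rw [← Int.natCast_dvd, Finset.dvd_gcd_iff]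
    simp
  have hg0 : (Finset.univ.gcd x).natAbs ≠ 0 := by
    rw [Int.natAbs_ne_zero, Ne, Finset.gcd_eq_zero_iff]
    intro h
    exact hx (funext fun i => h i (Finset.mem_univ i))
  have h1 : Finset.univ.gcd x = 1 ↔ (Finset.univ.gcd x).natAbs = 1 := by
    constructor
    · intro h; rw [h]; rfl
    · intro h
      rw [← Finset.normalize_gcd, ← Int.abs_eq_normalize, Int.abs_eq_natAbs, h]; rfl
  rw [← Finset.sum_filter]
  have hs : (Finset.Icc 1 B).filter (fun d : ℕ => ∀ i, (d : ℤ) ∣ x i) =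
      (Finset.univ.gcd x).natAbs.divisors := by
    ext d
    simp only [Finset.mem_filter, Finset.mem_Icc, Nat.mem_divisors, hiff]
    constructor
    · rintro ⟨_, h⟩; exact ⟨h, hg0⟩
    · rintro ⟨h, _⟩
      refine ⟨⟨Nat.pos_of_dvd_of_pos h (Nat.pos_of_ne_zero hg0), ?_⟩, h⟩
      obtain ⟨i, hi⟩ := Function.ne_iff.mp hx
      have h2 := (hiff d).2 h i
      have h3 := Int.le_of_dvd (abs_pos.2 hi) ((dvd_abs _ _).2 h2)
      have h4 := Finset.mem_Ico.1 (hxB i)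
      have h5 : |x i| ≤ B := abs_le.2 ⟨h4.1, h4.2.le⟩
      exact_mod_cast h3.trans h5
  rw [hs, ← ArithmeticFunction.coe_mul_zeta_apply, ArithmeticFunction.moebius_mul_coe_zeta,
    ArithmeticFunction.one_apply]
  simp only [h1]

lemma count_eq (n B : ℕ) (hn : 1 ≤ n) (hB : 1 ≤ B) :
    (vecBoxCount n {a : Fin n → ℤ | Finset.univ.gcd a = 1} B : ℤ) =
      ∑ d ∈ Finset.Icc 1 B, ArithmeticFunction.moebius d * ((mulCount B d : ℤ) ^ n - 1) := by
  have hset : {x ∈ {a : Fin n → ℤ | Finset.univ.gcd a = 1} | ∀ i, -(B : ℤ) ≤ x i ∧ x i < (B : ℤ)} =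
      ((((Fintype.piFinset (fun _ : Fin n => Finset.Ico (-(B : ℤ)) B)).erase 0).filter
      (fun x => Finset.univ.gcd x = 1) : Finset (Fin n → ℤ)) : Set (Fin n → ℤ)) := by
    ext x
    simp only [Set.mem_ofPred_eq, Finset.coe_filter, Finset.mem_erase, Fintype.mem_piFinset,
      Finset.mem_Ico]
    constructor
    · rintro ⟨h1, h2⟩
      refine ⟨⟨?_, h2⟩, h1⟩
      rintro rfl
      have : (Finset.univ : Finset (Fin n)).gcd (0 : Fin n → ℤ) = 0 :=
        Finset.gcd_eq_zero_iff.2 (fun _ _ => rfl)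
      rw [this] at h1
      exact zero_ne_one h1
    · rintro ⟨⟨_, h2⟩, h1⟩
      exact ⟨h1, h2⟩
  rw [vecBoxCount, hset, Set.ncard_coe_finset, Finset.card_filter]
  push_cast
  rw [Finset.sum_congr rfl (fun x hx => sum_moebius_gcd n B x (Finset.ne_of_mem_erase hx)
    (Fintype.mem_piFinset.1 (Finset.mem_of_mem_erase hx))), Finset.sum_comm]
  refine Finset.sum_congr rfl fun d _ => ?_
  rw [← card_nonzero n B d hB, ← Finset.sum_filter, Finset.sum_const, nsmul_eq_mul, mul_comm]

noncomputable def densTerm (n B d : ℕ) : ℝ :=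
  (ArithmeticFunction.moebius d : ℝ) * (((mulCount B d : ℝ) ^ n - 1) / (2 * B) ^ n)

lemma ratio_eq (n B : ℕ) (hn : 1 ≤ n) (hB : 1 ≤ B) :
    vecDensityRatio n {a : Fin n → ℤ | Finset.univ.gcd a = 1} B = ∑' d, densTerm n B d := by
  rw [tsum_eq_sum (s := Finset.Icc 1 B)]
  · have h := count_eq n B hn hB
    have h' : (vecBoxCount n {a : Fin n → ℤ | Finset.univ.gcd a = 1} B : ℝ) =
      ∑ d ∈ Finset.Icc 1 B,
        (ArithmeticFunction.moebius d : ℝ) * ((mulCount B d : ℝ) ^ n - 1) := by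
      exact_mod_cast congrArg (Int.cast : ℤ → ℝ) h
    rw [vecDensityRatio, h', Finset.sum_div]
    exact Finset.sum_congr rfl fun d _ => by rw [densTerm]; ring
  · intro d hd
    rw [Finset.mem_Icc] at hd
    rcases Nat.eq_zero_or_pos d with rfl | h0
    · simp [densTerm]
    · rw [densTerm, mulCount_large B d hB (by omega)]
      simp

lemma densTerm_bound (n B d : ℕ) (hB : 1 ≤ B) :
    ‖densTerm n B d‖ ≤ (3 / 2 : ℝ) ^ n * (1 / (d : ℝ) ^ n) := by
  have hnn : 0 ≤ (3 / 2 : ℝ) ^ n * (1 / (d : ℝ) ^ n) := by positivity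
  rcases Nat.eq_zero_or_pos d with rfl | h0
  · simpa [densTerm] using hnn
  by_cases hd : B < d
  · rw [densTerm, mulCount_large B d hB hd]
    simpa using hnn
  have hdB : (d : ℝ) ≤ B := by exact_mod_cast not_lt.1 hd
  have hd0 : (0 : ℝ) < d := by exact_mod_cast h0
  have hB0 : (0 : ℝ) < B := by linarith
  have hM := mulCount_abs B d h0
  have hM0 : 1 ≤ mulCount B d := by
    rw [mulCount, Nat.one_le_iff_ne_zero, Finset.card_ne_zero]
    exact ⟨0, by simp; omega⟩
  have hM1 : (1 : ℝ) ≤ mulCount B d := by exact_mod_cast hM0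
  have hMle : (mulCount B d : ℝ) ≤ 3 * B / d := by
    have h1 : (1 : ℝ) ≤ B / d := (one_le_div hd0).2 hdB
    have h2 := (abs_le.1 hM).2
    have e1 : 2 * (B : ℝ) / d = 2 * (B / d) := by ring
    have e2 : 3 * (B : ℝ) / d = 3 * (B / d) := by ring
    rw [e1] at h2
    rw [e2]
    linarith
  have hmu : |(ArithmeticFunction.moebius d : ℝ)| ≤ 1 := by
    exact_mod_cast ArithmeticFunction.abs_moebius_le_one (n := d)
  have hpow : (1 : ℝ) ≤ (mulCount B d : ℝ) ^ n := one_le_pow₀ hM1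
  have hden : (0 : ℝ) < (2 * B) ^ n := by positivity
  rw [densTerm, norm_mul, Real.norm_eq_abs, Real.norm_eq_abs,
    abs_of_nonneg (div_nonneg (by linarith) hden.le)]
  calc _ ≤ 1 * (((mulCount B d : ℝ) ^ n - 1) / (2 * B) ^ n) :=
        mul_le_mul_of_nonneg_right hmu (div_nonneg (by linarith) hden.le)
    _ ≤ (3 * B / d : ℝ) ^ n / (2 * B) ^ n := by
        rw [one_mul]
        apply div_le_div_of_nonneg_right _ hden.le
        have := pow_le_pow_left₀ (by linarith) hMle n
        linarith
    _ = (3 / 2 : ℝ) ^ n * (1 / (d : ℝ) ^ n) := by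
        rw [← div_pow, ← one_div_pow, ← mul_pow]
        congr 1
        field_simp

lemma densTerm_tendsto (n d : ℕ) (hn : 1 ≤ n) :
    Tendsto (fun B => densTerm n B d) atTop
      (𝓝 ((ArithmeticFunction.moebius d : ℝ) * (1 / (d : ℝ) ^ n))) := by
  rcases Nat.eq_zero_or_pos d with rfl | h0
  · simp [densTerm]
  have hd0 : (0 : ℝ) < d := by exact_mod_cast h0
  have hinv : Tendsto (fun B : ℕ => 1 / (2 * (B : ℝ))) atTop (𝓝 0) := by
    have := (tendsto_one_div_atTop_nhds_zero_nat (𝕜 := ℝ)).const_mul (1 / 2)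
    rw [mul_zero] at this
    refine this.congr fun B => ?_
    rw [one_div_mul_one_div]
  have hM : Tendsto (fun B : ℕ => (mulCount B d : ℝ) / (2 * B)) atTop (𝓝 (1 / d)) := by
    rw [tendsto_iff_norm_sub_tendsto_zero]
    refine squeeze_zero' (Eventually.of_forall fun _ => norm_nonneg _) ?_ hinv
    filter_upwards [eventually_ge_atTop 1] with B hB
    have hB0 : (0 : ℝ) < B := by exact_mod_cast hB
    have e : (mulCount B d : ℝ) / (2 * B) - 1 / d = ((mulCount B d : ℝ) - 2 * B / d) / (2 * B) := by
      field_simp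
    rw [e, norm_div, Real.norm_eq_abs, Real.norm_eq_abs, abs_of_pos (by positivity : (0:ℝ) < 2 * B)]
    exact div_le_div_of_nonneg_right (mulCount_abs B d h0) (by positivity)
  have := ((hM.pow n).sub (hinv.pow n)).const_mul (ArithmeticFunction.moebius d : ℝ)
  rw [zero_pow (by omega), sub_zero, one_div_pow] at this
  refine this.congr fun B => ?_
  rw [densTerm, div_pow, one_div_pow, sub_div]

theorem cesaro_density_of_coprime_tuples (n : ℕ) (hn : 2 ≤ n) :
    ∃ d : ℝ,
      HasVecDensity n {a : Fin n → ℤ | Finset.univ.gcd a = 1} d ∧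
      (d : ℂ) = (riemannZeta (n : ℂ))⁻¹ ∧
      (n = 2 → d = 6 / Real.pi ^ 2) := by
  have hs : 1 < ((n : ℂ)).re := by simp; omega
  have hlim : ((∑' d : ℕ, (ArithmeticFunction.moebius d : ℝ) * (1 / (d : ℝ) ^ n) : ℝ) : ℂ) =
      (riemannZeta (n : ℂ))⁻¹ := by
    have h := ArithmeticFunction.LSeries_zeta_mul_Lseries_moebius hs
    rw [ArithmeticFunction.LSeries_zeta_eq_riemannZeta hs] at h
    rw [← eq_inv_of_mul_eq_one_right h, Complex.ofReal_tsum, LSeries]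
    refine tsum_congr fun d => ?_
    rw [LSeries.term_def]
    split_ifs with h0
    · simp [h0]
    · push_cast
      rw [Complex.cpow_natCast]
      ring
  refine ⟨_, ?_, hlim, ?_⟩
  · have hT : Tendsto (fun B => ∑' d, densTerm n B d) atTop
        (𝓝 (∑' d : ℕ, (ArithmeticFunction.moebius d : ℝ) * (1 / (d : ℝ) ^ n))) := by
      refine tendsto_tsum_of_dominated_convergence
        (bound := fun d : ℕ => (3 / 2 : ℝ) ^ n * (1 / (d : ℝ) ^ n)) ?_ ?_ ?_
      · exact (Real.summable_one_div_nat_pow.2 (by omega)).mul_left _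
      · intro d
        exact densTerm_tendsto n d (by omega)
      · filter_upwards [eventually_ge_atTop 1] with B hB d
        exact densTerm_bound n B d hB
    refine hT.congr' ?_
    filter_upwards [eventually_ge_atTop 1] with B hB
    exact (ratio_eq n B (by omega) hB).symm
  · rintro rfl
    rw [Nat.cast_ofNat, riemannZeta_two, inv_div] at hlim
    exact_mod_cast hlim
end

section
/- Let 1 ≤ k ≤ n be integers. A k × n integer matrix A can be extended to an n × n matrix in GL_n(ℤ) if and only if there exists an n × k integer matrix B such that A·B = I_k, the k × k identity matrix. -/
theorem unimodular_iff_right_inverse (k n : ℕ) (hk : 1 ≤ k) (hkn : k ≤ n)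
    (A : Matrix (Fin k) (Fin n) ℤ) :
    IsUnimodularMat hkn A ↔ ∃ B : Matrix (Fin n) (Fin k) ℤ, A * B = 1 := by
  constructor
  · rintro ⟨M, hM, hA⟩
    have hu : IsUnit M.det := by
      rcases hM with h | h <;> rw [h] <;> simp
    refine ⟨M⁻¹.submatrix id (Fin.castLE hkn), ?_⟩
    have hA' : A = M.submatrix (Fin.castLE hkn) id := by
      ext i j
      exact (hA i j).symm
    rw [hA']
    have h := Matrix.mul_nonsing_inv M hu
    ext i j
    have h2 := congrFun (congrFun h (Fin.castLE hkn i)) (Fin.castLE hkn j)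
    rw [Matrix.mul_apply] at h2 ⊢
    simp only [Matrix.submatrix_apply, id]
    rw [h2]
    simp [Matrix.one_apply]
  · rintro ⟨B, hB⟩
    obtain ⟨m, rfl⟩ := Nat.exists_eq_add_of_le hkn
    have hfB : ∀ y, A.mulVecLin (B.mulVecLin y) = y := by
      intro y
      simp [Matrix.mulVec_mulVec, hB]
    let f := A.mulVecLin
    let g := B.mulVecLin
    have hfg : ∀ y, f (g y) = y := hfB
    let K := LinearMap.ker f
    let p : (Fin (k + m) → ℤ) →ₗ[ℤ] K :=
      (LinearMap.id - g ∘ₗ f).codRestrict K (by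
        intro x
        simp [K, LinearMap.mem_ker, hfg])
    have hp : ∀ x, (p x : Fin (k + m) → ℤ) = x - g (f x) := fun x => rfl
    let e : (Fin (k + m) → ℤ) ≃ₗ[ℤ] (Fin k → ℤ) × K :=
      LinearEquiv.ofLinear (f.prod p) (g.coprod K.subtype)
        (by
          refine LinearMap.ext ?_
          rintro ⟨y, z⟩
          have hz : f z = 0 := z.2
          refine Prod.ext ?_ (Subtype.ext ?_)
          · simp [hfg, hz]
          · simp [hp, hfg, hz])
        (by
          refine LinearMap.ext fun x => ?_
          simp [hp])
    have hrank : Module.finrank ℤ K = m := by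
      have h := e.finrank_eq
      rw [Module.finrank_prod] at h
      simp at h
      exact h.symm
    let b : Module.Basis (Fin m) ℤ K := Module.finBasisOfFinrankEq ℤ K hrank
    let e2 : (Fin (k + m) → ℤ) ≃ₗ[ℤ] (Fin (k + m) → ℤ) :=
      e ≪≫ₗ (LinearEquiv.refl ℤ (Fin k → ℤ)).prodCongr b.equivFun ≪≫ₗ
        (LinearEquiv.sumArrowLequivProdArrow (Fin k) (Fin m) ℤ ℤ).symm ≪≫ₗ
        LinearEquiv.funCongrLeft ℤ ℤ finSumFinEquiv.symm
    refine ⟨LinearMap.toMatrix' (e2 : (Fin (k + m) → ℤ) →ₗ[ℤ] _), ?_, ?_⟩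
    · rw [LinearMap.det_toMatrix']
      exact Int.isUnit_iff.mp (LinearEquiv.isUnit_det' e2)
    · intro i j
      have h1 : ∀ x, e2 x (Fin.castAdd m i) = f x i := by
        intro x
        simp [e2, LinearEquiv.funCongrLeft_apply, LinearMap.funLeft_apply, e]
      have h2 : Fin.castLE hkn i = Fin.castAdd m i := rfl
      rw [h2, LinearMap.toMatrix'_apply]
      simp only [LinearEquiv.coe_coe]
      rw [h1]
      simp [f]
end
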